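/- Let G be a tree with vertex set V and let Σ be a symmetric positive definite real matrix indexed by V×V that is Markov with respect to G. Let a, c ∈ V be distinct and let Z1, Z2 ⊆ V \ {a, c} be such that for every z ∈ Z2 both path(a, z) and path(c, z) contain a vertex of Z1. Then ρ²_{ac|Z1} ≤ ρ²_{ac|Z2}. -/

import Mathlib

open Matrix

variable {V : Type*}

/-- Partial covariance `σ_{uv|Z} = Σ_{uv} − Σ_{uZ} (Σ_{ZZ})⁻¹ Σ_{Zv}`. -/
noncomputable def pcov [Fintype V] [DecidableEq V] (S : Matrix V V ℝ) (u v : V) (Z : Finset V) : ℝ :=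
  S u v - ∑ i : {x // x ∈ Z}, ∑ j : {x // x ∈ Z},
    S u (i : V) * (Matrix.of (fun i j : {x // x ∈ Z} => S (i : V) (j : V)))⁻¹ i j * S (j : V) v

/-- Squared partial correlation `ρ²_{uv|Z}`. -/
noncomputable def rho2 [Fintype V] [DecidableEq V] (S : Matrix V V ℝ) (u v : V) (Z : Finset V) : ℝ :=
  pcov S u v Z ^ 2 / (pcov S u u Z * pcov S v v Z)
/-- `S` separates `A` from `C` in `G`: every path in `G` from a vertex of `A`
to a vertex of `C` contains a vertex of `S`. -/
def Separates {W : Type*} (G : SimpleGraph W) (A C S : Set W) : Prop :=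
  ∀ ⦃a⦄, a ∈ A → ∀ ⦃c⦄, c ∈ C → ∀ p : G.Walk a c, p.IsPath → ∃ s ∈ S, s ∈ p.support

/-- `v` lies on the (unique, for a tree) path joining `x` and `y` in `G`. -/
def OnPath {W : Type*} (G : SimpleGraph W) (x y v : W) : Prop :=
  ∃ p : G.Walk x y, p.IsPath ∧ v ∈ p.support

/-- `Σ` is Markov with respect to `G`: separation implies vanishing partial covariance. -/
def MarkovTree [Fintype V] [DecidableEq V] (G : SimpleGraph V) (S : Matrix V V ℝ) : Prop :=
  ∀ u v : V, u ≠ v → ∀ Z : Finset V, u ∉ Z → v ∉ Z →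
    Separates G {u} {v} (↑Z : Set V) → pcov S u v Z = 0

section PartialCovariance

variable [Fintype V] [DecidableEq V]

/-- The coefficients of the regression of coordinate `v` on the coordinates in `Z`. -/
theorem exists_regression {S : Matrix V V ℝ} (hpd : S.PosDef) (v : V) (Z : Finset V) :
    ∃ b : V → ℝ, (∀ i, i ∉ Z → b i = 0) ∧ (∀ u, pcov S u v Z = S u v - (S *ᵥ b) u) ∧
      ∀ z ∈ Z, (S *ᵥ b) z = S z v := by
  let M : Matrix {x // x ∈ Z} {x // x ∈ Z} ℝ :=
    Matrix.of (fun i j : {x // x ∈ Z} => S (i : V) (j : V))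
  have hMpd : M.PosDef := hpd.submatrix Subtype.val_injective
  let y : {x // x ∈ Z} → ℝ := M⁻¹ *ᵥ fun j => S (j : V) v
  let b : V → ℝ := fun i => if h : i ∈ Z then y ⟨i, h⟩ else 0
  have hb : ∀ u, (S *ᵥ b) u = ∑ i : {x // x ∈ Z}, S u (i : V) * y i := by
    intro u
    have h1 : (S *ᵥ b) u = ∑ i ∈ Z, S u i * b i := by
      rw [Matrix.mulVec, dotProduct]
      refine (Finset.sum_subset (Finset.subset_univ Z) fun i _ hi => ?_).symm
      simp [b, hi]
    rw [h1, ← Finset.sum_coe_sort Z]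
    exact Finset.sum_congr rfl fun i _ => by simp [b]
  refine ⟨b, fun i hi => by simp [b, hi], fun u => ?_, fun z hz => ?_⟩
  · rw [hb, pcov]
    congr 1
    refine Finset.sum_congr rfl fun i _ => ?_
    simp only [y, Matrix.mulVec, dotProduct, Finset.mul_sum, mul_assoc]
    rfl
  · have h2 : M *ᵥ y = fun j : {x // x ∈ Z} => S (j : V) v := by
      simp only [y]
      rw [Matrix.mulVec_mulVec, Matrix.mul_nonsing_inv _ hMpd.det_pos.ne'.isUnit,
        Matrix.one_mulVec]
    rw [hb]
    exact congrFun h2 ⟨z, hz⟩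

theorem pcov_eq_of_regression {S : Matrix V V ℝ} (hpd : S.PosDef) {v : V} {Z : Finset V}
    {b : V → ℝ} (hb : ∀ i, i ∉ Z → b i = 0) (hz : ∀ z ∈ Z, (S *ᵥ b) z = S z v) (u : V) :
    pcov S u v Z = S u v - (S *ᵥ b) u := by
  obtain ⟨b', hb', hp, hz'⟩ := exists_regression hpd v Z
  have hbb : b - b' = 0 := by
    by_contra hne
    have hpos := hpd.dotProduct_mulVec_pos hne
    refine hpos.ne' (Finset.sum_eq_zero fun i _ => ?_)
    by_cases hi : i ∈ Z
    · simp [Matrix.mulVec_sub, hz i hi, hz' i hi]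
    · simp [hb i hi, hb' i hi]
  rw [hp, sub_eq_zero.mp hbb]

theorem pcov_eq_quadratic {S : Matrix V V ℝ} (hpd : S.PosDef) (Z : Finset V) :
    ∃ d : V → V → ℝ, (∀ u, u ∉ Z → d u u = 1) ∧
      ∀ u v, u ∉ Z → pcov S u v Z = d u ⬝ᵥ (S *ᵥ d v) := by
  choose b hb hp hz using fun v => exists_regression hpd v Z
  refine ⟨fun v => Pi.single v 1 - b v, fun u hu => by simp [hb u u hu], fun u v hu => ?_⟩
  have hS : ∀ i, (S *ᵥ (Pi.single v 1 - b v)) i = S i v - (S *ᵥ b v) i := by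
    intro i
    simp [Matrix.mulVec_sub]
  rw [dotProduct, Finset.sum_eq_single u]
  · simp only [hS, hp v u]
    simp [hb u u hu]
  · intro i _ hi
    by_cases hiZ : i ∈ Z
    · simp [hS, hz v i hiZ]
    · simp [hb u i hiZ, hi]
  · simp

theorem pcov_self_pos {S : Matrix V V ℝ} (hpd : S.PosDef) {u : V} {Z : Finset V} (hu : u ∉ Z) :
    0 < pcov S u u Z := by
  obtain ⟨d, hd, hp⟩ := pcov_eq_quadratic hpd Z
  rw [hp u u hu]
  have hne : d u ≠ 0 := fun h0 => by simpa [h0] using hd u hu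
  simpa using hpd.dotProduct_mulVec_pos hne

theorem pcov_comm {S : Matrix V V ℝ} (hsym : S.IsSymm) (hpd : S.PosDef) {u v : V} {Z : Finset V}
    (hu : u ∉ Z) (hv : v ∉ Z) : pcov S u v Z = pcov S v u Z := by
  obtain ⟨d, -, hp⟩ := pcov_eq_quadratic hpd Z
  rw [hp u v hu, hp v u hv, Matrix.dotProduct_mulVec, ← Matrix.mulVec_transpose, hsym.eq,
    dotProduct_comm]

/-- The recursion for partial covariances when one more vertex is conditioned on. -/
theorem pcov_insert {S : Matrix V V ℝ} (hpd : S.PosDef) {w : V} {Z : Finset V} (hw : w ∉ Z)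
    (u v : V) : pcov S u v (insert w Z) =
      pcov S u v Z - pcov S u w Z * pcov S w v Z / pcov S w w Z := by
  obtain ⟨b, hb, hp, hz⟩ := exists_regression hpd v Z
  obtain ⟨b', hb', hp', hz'⟩ := exists_regression hpd w Z
  have hne := (pcov_self_pos hpd hw).ne'
  set t := pcov S w v Z / pcov S w w Z with ht
  have hS : ∀ i, (S *ᵥ (b + t • (Pi.single w 1 - b'))) i = (S *ᵥ b) i + t * pcov S i w Z := by
    intro i
    simp [Matrix.mulVec_add, Matrix.mulVec_smul, Matrix.mulVec_sub, hp' i]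
  rw [pcov_eq_of_regression hpd (b := b + t • (Pi.single w 1 - b')), hS, hp u, ht]
  · ring
  · intro i hi
    rw [Finset.mem_insert, not_or] at hi
    simp [hb i hi.2, hb' i hi.2, hi.1]
  · intro z hzi
    rw [hS]
    rcases Finset.mem_insert.mp hzi with rfl | hzZ
    · rw [ht, div_mul_cancel₀ _ hne, hp]
      ring
    · rw [hp' z, hz z hzZ, hz' z hzZ]
      ring

theorem pcov_sq_le {S : Matrix V V ℝ} (hsym : S.IsSymm) (hpd : S.PosDef) {u v : V} {Z : Finset V}
    (hu : u ∉ Z) (hv : v ∉ Z) : pcov S u v Z ^ 2 ≤ pcov S u u Z * pcov S v v Z := by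
  by_cases huv : u = v
  · rw [huv, sq]
  · have h1 : 0 < pcov S u u (insert v Z) := pcov_self_pos hpd (by simp [huv, hu])
    have hv0 := pcov_self_pos hpd hv
    rw [pcov_insert hpd hv, pcov_comm hsym hpd hv hu, sub_pos, div_lt_iff₀ hv0] at h1
    nlinarith

end PartialCovariance

/-- The effect of conditioning on a leaf `w` of a star with centre `p` and leaves `a`, `c`, `w`,
in terms of the (co)variances: `A`, `C`, `P`, `W` are variances and `x`, `y`, `z` the covariances
of `a`, `c`, `w` with `p`. -/
theorem star_correlation_le {A C P W x y z : ℝ} (hA : 0 < A) (hC : 0 < C) (hP : 0 < P) (hW : 0 < W)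
    (hx : x ^ 2 ≤ A * P) (hy : y ^ 2 ≤ C * P) (hz : z ^ 2 ≤ W * P)
    (hA' : 0 < A - (x * z / P) * (x * z / P) / W) (hC' : 0 < C - (y * z / P) * (y * z / P) / W) :
    (x * y / P - (x * z / P) * (y * z / P) / W) ^ 2 /
      ((A - (x * z / P) * (x * z / P) / W) * (C - (y * z / P) * (y * z / P) / W)) ≤
    (x * y / P) ^ 2 / (A * C) := by
  set r := z ^ 2 / (W * P) with hr
  have hr0 : 0 ≤ r := by positivity
  have hr1 : r ≤ 1 := (div_le_one (by positivity)).mpr hz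
  have e1 : x * y / P - (x * z / P) * (y * z / P) / W = (x * y / P) * (1 - r) := by
    rw [hr]; field_simp
  have e2 : A - (x * z / P) * (x * z / P) / W = A - r * (x ^ 2 / P) := by
    rw [hr]; field_simp
  have e3 : C - (y * z / P) * (y * z / P) / W = C - r * (y ^ 2 / P) := by
    rw [hr]; field_simp
  rw [e1, e2, e3]
  rw [e2] at hA'
  rw [e3] at hC'
  have hx' : x ^ 2 / P ≤ A := (div_le_iff₀ hP).mpr hx
  have hy' : y ^ 2 / P ≤ C := (div_le_iff₀ hP).mpr hy
  have h1 : A * (1 - r) ≤ A - r * (x ^ 2 / P) := by nlinarith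
  have h2 : C * (1 - r) ≤ C - r * (y ^ 2 / P) := by nlinarith
  have h3 : (A * (1 - r)) * (C * (1 - r)) ≤ (A - r * (x ^ 2 / P)) * (C - r * (y ^ 2 / P)) :=
    mul_le_mul h1 h2 (mul_nonneg hC.le (sub_nonneg.mpr hr1)) hA'.le
  rw [div_le_div_iff₀ (mul_pos hA' hC') (mul_pos hA hC)]
  calc (x * y / P * (1 - r)) ^ 2 * (A * C)
      = (x * y / P) ^ 2 * ((A * (1 - r)) * (C * (1 - r))) := by ring
    _ ≤ _ := mul_le_mul_of_nonneg_left h3 (sq_nonneg _)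

section Tree

variable {W : Type*} {G : SimpleGraph W}

theorem OnPath.mem_support (hG : G.IsTree) {x y v : W} (h : OnPath G x y v) (q : G.Walk x y) :
    v ∈ q.support := by
  classical
  obtain ⟨p, hp, hv⟩ := h
  have hpq : p = q.toPath :=
    congrArg Subtype.val ((hG.isAcyclic.subsingleton_path x y).elim ⟨p, hp⟩ q.toPath)
  rw [hpq] at hv
  exact q.support_toPath_subset_support hv

theorem onPath_of_forall_walk (hG : G.IsTree) {x y v : W}
    (h : ∀ q : G.Walk x y, v ∈ q.support) : OnPath G x y v := by
  obtain ⟨p, hp, -⟩ := hG.existsUnique_path x y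
  exact ⟨p, hp, h p⟩

theorem OnPath.symm {x y v : W} (h : OnPath G x y v) : OnPath G y x v := by
  obtain ⟨p, hp, hv⟩ := h
  exact ⟨p.reverse, hp.reverse, by simpa using hv⟩

/-- A path of a tree contains the path from its initial vertex to any vertex on it. -/
theorem OnPath.trans_left (hG : G.IsTree) {x y v u : W} (hv : OnPath G x y v)
    (hu : OnPath G x v u) : OnPath G x y u := by
  classical
  obtain ⟨p, hp, hvp⟩ := hv
  exact ⟨p, hp, p.support_takeUntil_subset_support hvp (hu.mem_support hG _)⟩

theorem onPath_of_adj (hG : G.IsTree) {x y w m : W} (hadj : G.Adj w m)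
    (hm : OnPath G x y m) (hw : ¬ OnPath G x y w) : OnPath G w x m := by
  classical
  obtain ⟨p, hp, -⟩ := hG.existsUnique_path m x
  refine ⟨p.cons hadj, ?_, by simp⟩
  rw [SimpleGraph.Walk.cons_isPath_iff]
  exact ⟨hp, fun h => hw (hm.trans_left hG (OnPath.symm ⟨p, hp, h⟩))⟩

/-- Any three vertices of a tree have a median. -/
theorem exists_median (hG : G.IsTree) (a c w : W) :
    ∃ m, OnPath G a c m ∧ OnPath G w a m ∧ OnPath G w c m := by
  obtain ⟨q⟩ := hG.connected.preconnected w a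
  induction q with
  | nil =>
    refine ⟨_, onPath_of_forall_walk hG fun q => q.start_mem_support,
      onPath_of_forall_walk hG fun q => q.start_mem_support,
      onPath_of_forall_walk hG fun q => q.start_mem_support⟩
  | @cons w w' a hadj q ih =>
    by_cases hw : OnPath G a c w
    · exact ⟨w, hw, onPath_of_forall_walk hG fun q => q.start_mem_support,
        onPath_of_forall_walk hG fun q => q.start_mem_support⟩
    obtain ⟨m, hm, hma, hmc⟩ := ih
    refine ⟨m, hm, ?_⟩
    by_cases hmw : m = w'
    · subst hmw
      exact ⟨onPath_of_adj hG hadj hm hw,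
        onPath_of_adj hG hadj hm.symm fun h => hw h.symm⟩
    · have key : ∀ t, OnPath G w' t m → OnPath G w t m := fun t ht =>
        onPath_of_forall_walk hG fun r => by
          have := ht.mem_support hG (r.cons hadj.symm)
          simpa [hmw] using this
      exact ⟨key a hma, key c hmc⟩

end Tree

section Markov

variable [Fintype V] [DecidableEq V] {G : SimpleGraph V} {S : Matrix V V ℝ}

theorem MarkovTree.pcov_eq_zero (hM : MarkovTree G S) (hG : G.IsTree) {u v w : V} {Z : Finset V}
    (huv : u ≠ v) (hu : u ∉ Z) (hv : v ∉ Z) (hw : w ∈ Z) (h : OnPath G u v w) :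
    pcov S u v Z = 0 := by
  refine hM u v huv Z hu hv ?_
  rintro _ rfl _ rfl p -
  exact ⟨w, hw, h.mem_support hG p⟩

theorem MarkovTree.pcov_eq_mul_div (hM : MarkovTree G S) (hG : G.IsTree) (hsym : S.IsSymm)
    (hpd : S.PosDef) {u v m : V} {Z : Finset V} (huv : u ≠ v) (hu : u ∉ Z) (hv : v ∉ Z)
    (hm : m ∉ Z) (h : OnPath G u v m) :
    pcov S u v Z = pcov S u m Z * pcov S v m Z / pcov S m m Z := by
  have hne := (pcov_self_pos hpd hm).ne'
  rw [pcov_comm hsym hpd hv hm]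
  by_cases hum : u = m
  · subst hum
    field_simp
  by_cases hvm : v = m
  · subst hvm
    field_simp
  have h0 : pcov S u v (insert m Z) = 0 :=
    hM.pcov_eq_zero hG huv (by simp [hum, hu]) (by simp [hvm, hv]) (Finset.mem_insert_self m Z) h
  rw [pcov_insert hpd hm] at h0
  linarith

/-- Conditioning on a further vertex off the path does not increase the squared correlation. -/
theorem MarkovTree.rho2_insert_le (hM : MarkovTree G S) (hG : G.IsTree) (hsym : S.IsSymm)
    (hpd : S.PosDef) {a c w : V} (hac : a ≠ c) {Z : Finset V} (hZ : ∀ z ∈ Z, ¬ OnPath G a c z)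
    (haZ : a ∉ Z) (hcZ : c ∉ Z) (hwZ : w ∉ Z) (hwa : w ≠ a) (hwc : w ≠ c) :
    rho2 S a c (insert w Z) ≤ rho2 S a c Z := by
  obtain ⟨m, hm, hma, hmc⟩ := exists_median hG a c w
  have hmZ : m ∉ Z := fun h => hZ m h hm
  have hA' : 0 < pcov S a a (insert w Z) := pcov_self_pos hpd (by simp [hwa.symm, haZ])
  have hC' : 0 < pcov S c c (insert w Z) := pcov_self_pos hpd (by simp [hwc.symm, hcZ])
  rw [rho2, rho2]
  rw [pcov_insert hpd hwZ, pcov_comm hsym hpd hwZ haZ,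
    hM.pcov_eq_mul_div hG hsym hpd hwa.symm haZ hwZ hmZ hma.symm] at hA'
  rw [pcov_insert hpd hwZ, pcov_comm hsym hpd hwZ hcZ,
    hM.pcov_eq_mul_div hG hsym hpd hwc.symm hcZ hwZ hmZ hmc.symm] at hC'
  simp only [pcov_insert hpd hwZ]
  rw [pcov_comm hsym hpd hwZ haZ, pcov_comm hsym hpd hwZ hcZ,
    hM.pcov_eq_mul_div hG hsym hpd hac haZ hcZ hmZ hm,
    hM.pcov_eq_mul_div hG hsym hpd hwa.symm haZ hwZ hmZ hma.symm,
    hM.pcov_eq_mul_div hG hsym hpd hwc.symm hcZ hwZ hmZ hmc.symm]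
  exact star_correlation_le (pcov_self_pos hpd haZ) (pcov_self_pos hpd hcZ)
    (pcov_self_pos hpd hmZ) (pcov_self_pos hpd hwZ) (pcov_sq_le hsym hpd haZ hmZ)
    (pcov_sq_le hsym hpd hcZ hmZ) (pcov_sq_le hsym hpd hwZ hmZ) hA' hC'

theorem MarkovTree.rho2_union_le (hM : MarkovTree G S) (hG : G.IsTree) (hsym : S.IsSymm)
    (hpd : S.PosDef) {a c : V} (hac : a ≠ c) {T Z : Finset V} (hT : ∀ z ∈ T, ¬ OnPath G a c z)
    (hZ : ∀ z ∈ Z, ¬ OnPath G a c z) : rho2 S a c (T ∪ Z) ≤ rho2 S a c Z := by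
  have ha : OnPath G a c a := onPath_of_forall_walk hG fun q => q.start_mem_support
  have hc : OnPath G a c c := onPath_of_forall_walk hG fun q => q.end_mem_support
  induction T using Finset.induction_on with
  | empty => simp
  | insert w T _ ih =>
    have hw := hT w (Finset.mem_insert_self w T)
    have hT' : ∀ z ∈ T, ¬ OnPath G a c z := fun z hz => hT z (Finset.mem_insert_of_mem hz)
    rw [Finset.insert_union]
    by_cases hwZ : w ∈ T ∪ Z
    · rw [Finset.insert_eq_of_mem hwZ]
      exact ih hT'
    have hTZ : ∀ z ∈ T ∪ Z, ¬ OnPath G a c z := fun z hz =>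
      (Finset.mem_union.mp hz).elim (hT' z) (hZ z)
    refine (hM.rho2_insert_le hG hsym hpd hac hTZ (fun h => hTZ a h ha) (fun h => hTZ c h hc) hwZ
      ?_ ?_).trans (ih hT')
    · rintro rfl
      exact hw ha
    · rintro rfl
      exact hw hc

/-- Vertices separated from `u` by `Z` are redundant in conditioning. -/
theorem MarkovTree.pcov_union_eq (hM : MarkovTree G S) (hG : G.IsTree) (hpd : S.PosDef) {u : V}
    {T Z : Finset V} (huT : u ∉ T) (huZ : u ∉ Z) (hT : ∀ z ∈ T, ∃ w ∈ Z, OnPath G u z w) (v : V) :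
    pcov S u v (T ∪ Z) = pcov S u v Z := by
  induction T using Finset.induction_on with
  | empty => simp
  | insert z T _ ih =>
    rw [Finset.mem_insert, not_or] at huT
    have ih := ih huT.2 fun z hz => hT z (Finset.mem_insert_of_mem hz)
    rw [Finset.insert_union]
    by_cases hz : z ∈ T ∪ Z
    · rw [Finset.insert_eq_of_mem hz, ih]
    obtain ⟨w, hw, hp⟩ := hT z (Finset.mem_insert_self z T)
    rw [pcov_insert hpd hz, ih, hM.pcov_eq_zero hG huT.1 (by simp [huT.2, huZ]) hz
      (Finset.mem_union_right T hw) hp]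
    simp

end Markov

/-- Corollary 2: on a Gaussian tree, if for each `z ∈ Z2` both
`path(a,z)` and `path(c,z)` meet `Z1`, then `ρ²_{ac|Z1} ≤ ρ²_{ac|Z2}`. -/
theorem stmt_15 [Fintype V] [DecidableEq V] [Nonempty V]
    (G : SimpleGraph V) (hG : G.IsTree)
    (S : Matrix V V ℝ) (hsym : S.IsSymm) (hpd : S.PosDef) (hM : MarkovTree G S)
    (a c : V) (hac : a ≠ c)
    (Z1 Z2 : Finset V) (haZ1 : a ∉ Z1) (hcZ1 : c ∉ Z1) (haZ2 : a ∉ Z2) (hcZ2 : c ∉ Z2)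
    (h : ∀ z ∈ Z2, (∃ w ∈ Z1, OnPath G a z w) ∧ (∃ w ∈ Z1, OnPath G c z w)) :
    rho2 S a c Z1 ≤ rho2 S a c Z2 := by
  by_cases hZ1 : ∃ w ∈ Z1, OnPath G a c w
  · obtain ⟨w, hw, hp⟩ := hZ1
    rw [rho2, hM.pcov_eq_zero hG hac haZ1 hcZ1 hw hp, rho2]
    have := pcov_self_pos hpd haZ2
    have := pcov_self_pos hpd hcZ2
    simp only [ne_eq, OfNat.ofNat_ne_zero, not_false_eq_true, zero_pow, zero_div]
    positivity
  · push Not at hZ1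
    have hZ2 : ∀ z ∈ Z2, ¬ OnPath G a c z := fun z hz hp => by
      obtain ⟨w, hw, hwp⟩ := (h z hz).1
      exact hZ1 w hw (hp.trans_left hG hwp)
    have ha := hM.pcov_union_eq hG hpd haZ2 haZ1 fun z hz => (h z hz).1
    have hc := hM.pcov_union_eq hG hpd hcZ2 hcZ1 fun z hz => (h z hz).2
    have heq : rho2 S a c Z1 = rho2 S a c (Z1 ∪ Z2) := by
      rw [Finset.union_comm, rho2, rho2, ha, ha, hc]
    rw [heq]
    exact hM.rho2_union_le hG hsym hpd hac hZ1 hZ2
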